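/- Let A, B, C, D, E ∈ ℂ³ be nonzero vectors representing five points of ℙ²(ℂ), no three of which are collinear (every three of the vectors are linearly independent), and let F ∈ ℂ³ be a nonzero vector. Then there exists a nonzero homogeneous degree-2 polynomial in three variables over ℂ vanishing at all six of A, B, C, D, E, F if and only if [ACE]·[ABF]·[CDF]·[BDE] = [ACF]·[ABE]·[CDE]·[BDF]. -/

import Mathlib

open MvPolynomial Matrix

/-- The bracket `[ABC]`: the determinant of the 3×3 matrix whose columns are `A`, `B`, `C`. -/
def bracket (A B C : Fin 3 → ℂ) : ℂ :=
  Matrix.det (Matrix.of ![A, B, C])ᵀ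

theorem bracket_expand (A B C : Fin 3 → ℂ) : bracket A B C =
    A 0 * (B 1 * C 2 - B 2 * C 1) - A 1 * (B 0 * C 2 - B 2 * C 0)
      + A 2 * (B 0 * C 1 - B 1 * C 0) := by
  simp [bracket, Matrix.det_fin_three]
  ring

theorem bracket_ne_zero_of_indep (A B C : Fin 3 → ℂ) (h : LinearIndependent ℂ ![A, B, C]) :
    bracket A B C ≠ 0 := by
  have h1 : LinearIndependent ℂ (Matrix.of ![A, B, C]).row := h
  rw [Matrix.linearIndependent_rows_iff_isUnit, Matrix.isUnit_iff_isUnit_det] at h1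
  rw [bracket, Matrix.det_transpose]
  exact h1.ne_zero

theorem exists_coords (A B C : Fin 3 → ℂ) (h : LinearIndependent ℂ ![A, B, C])
    (X : Fin 3 → ℂ) : ∃ a b c : ℂ, X = a • A + b • B + c • C := by
  have hs := h.span_eq_top_of_card_eq_finrank' (by simp)
  have hX : X ∈ Submodule.span ℂ (Set.range ![A, B, C]) := by rw [hs]; trivial
  rw [Submodule.mem_span_range_iff_exists_fun] at hX
  obtain ⟨c, hc⟩ := hX
  refine ⟨c 0, c 1, c 2, ?_⟩
  rw [← hc]
  simp [Fin.sum_univ_three]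

/-- A homogeneous quadratic polynomial obeys the law of a quadratic form. -/
theorem eval_quadratic (q : MvPolynomial (Fin 3) ℂ) (hq : q.IsHomogeneous 2)
    (A B C : Fin 3 → ℂ) (a b c : ℂ) :
    eval (a • A + b • B + c • C) q =
      a ^ 2 * eval A q + b ^ 2 * eval B q + c ^ 2 * eval C q
      + a * b * (eval (A + B) q - eval A q - eval B q)
      + a * c * (eval (A + C) q - eval A q - eval C q)
      + b * c * (eval (B + C) q - eval B q - eval C q) := by
  simp only [MvPolynomial.eval_eq', Finset.mul_sum, ← Finset.sum_add_distrib,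
    ← Finset.sum_sub_distrib]
  refine Finset.sum_congr rfl fun d hd => ?_
  have h2 := hq (MvPolynomial.mem_support_iff.mp hd)
  have h2' : d 0 + d 1 + d 2 = 2 := by
    rw [Finsupp.weight_apply, Finsupp.sum_fintype _ _ (by simp)] at h2
    simpa [Fin.sum_univ_three] using h2
  simp only [Fin.prod_univ_three, Pi.add_apply, Pi.smul_apply, smul_eq_mul]
  generalize coeff d q = k
  generalize d 0 = x at *
  generalize d 1 = y at *
  generalize d 2 = z at *
  have hx : x ≤ 2 := by omega
  have hy : y ≤ 2 := by omega
  obtain rfl : z = 2 - x - y := by omega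
  interval_cases x <;> interval_cases y <;> first | omega | (norm_num; ring)

/-- The linear form `X ↦ [ABX]` as a polynomial. -/
noncomputable def lineForm (A B : Fin 3 → ℂ) : MvPolynomial (Fin 3) ℂ :=
  MvPolynomial.C (A 1 * B 2 - A 2 * B 1) * X 0 + MvPolynomial.C (A 2 * B 0 - A 0 * B 2) * X 1
    + MvPolynomial.C (A 0 * B 1 - A 1 * B 0) * X 2

theorem eval_lineForm (A B P : Fin 3 → ℂ) : eval P (lineForm A B) = bracket A B P := by
  rw [bracket_expand]
  simp [lineForm]
  ring

theorem lineForm_homogeneous (A B : Fin 3 → ℂ) : (lineForm A B).IsHomogeneous 1 := by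
  unfold lineForm
  exact ((MvPolynomial.isHomogeneous_C_mul_X _ _).add
    (MvPolynomial.isHomogeneous_C_mul_X _ _)).add (MvPolynomial.isHomogeneous_C_mul_X _ _)

/-- Five points `A, B, C, D, E` of `ℙ²(ℂ)`, no three collinear, together with a point `F`
lie on a conic iff `[ACE]·[ABF]·[CDF]·[BDE] = [ACF]·[ABE]·[CDE]·[BDF]`. -/
theorem six_points_on_conic_iff_bracket_monomials
    (A B C D E F : Fin 3 → ℂ)
    (hA : A ≠ 0) (hB : B ≠ 0) (hC : C ≠ 0) (hD : D ≠ 0) (hE : E ≠ 0) (hF : F ≠ 0)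
    (h3 : ∀ i j k : Fin 5, i ≠ j → i ≠ k → j ≠ k →
      LinearIndependent ℂ ![![A, B, C, D, E] i, ![A, B, C, D, E] j, ![A, B, C, D, E] k]) :
    (∃ q : MvPolynomial (Fin 3) ℂ, q ≠ 0 ∧ q.IsHomogeneous 2 ∧
      eval A q = 0 ∧ eval B q = 0 ∧ eval C q = 0 ∧
      eval D q = 0 ∧ eval E q = 0 ∧ eval F q = 0) ↔
    bracket A C E * bracket A B F * bracket C D F * bracket B D E =
      bracket A C F * bracket A B E * bracket C D E * bracket B D F := by
  have hABC := h3 0 1 2 (by decide) (by decide) (by decide)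
  have hABD := h3 0 1 3 (by decide) (by decide) (by decide)
  have hABE := h3 0 1 4 (by decide) (by decide) (by decide)
  have hCDE := h3 2 3 4 (by decide) (by decide) (by decide)
  change LinearIndependent ℂ ![A, B, C] at hABC
  change LinearIndependent ℂ ![A, B, D] at hABD
  change LinearIndependent ℂ ![A, B, E] at hABE
  change LinearIndependent ℂ ![C, D, E] at hCDE
  constructor
  · rintro ⟨q, q0, hq, qA, qB, qC, qD, qE, qF⟩
    have law := eval_quadratic q hq A B C
    rw [qA, qB, qC] at law
    obtain ⟨d1, d2, d3, rfl⟩ := exists_coords A B C hABC D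
    obtain ⟨e1, e2, e3, rfl⟩ := exists_coords A B C hABC E
    obtain ⟨f1, f2, f3, rfl⟩ := exists_coords A B C hABC F
    rw [law] at qD qE qF
    generalize hp : eval (A + B) q - 0 - 0 = p at *
    generalize hr : eval (A + C) q - 0 - 0 = r at *
    generalize hs : eval (B + C) q - 0 - 0 = s at *
    have hne : ![p, r, s] ≠ 0 := by
      intro h0
      have p0 : p = 0 := congrFun h0 0
      have r0 : r = 0 := congrFun h0 1
      have s0 : s = 0 := congrFun h0 2
      apply q0
      apply MvPolynomial.funext
      intro P
      obtain ⟨a, b, c, rfl⟩ := exists_coords A B C hABC P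
      rw [law, p0, r0, s0]
      simp
    have hdet : (!![d1 * d2, d1 * d3, d2 * d3; e1 * e2, e1 * e3, e2 * e3;
        f1 * f2, f1 * f3, f2 * f3] : Matrix (Fin 3) (Fin 3) ℂ).det = 0 := by
      rw [← Matrix.exists_mulVec_eq_zero_iff]
      refine ⟨_, hne, ?_⟩
      ext i
      fin_cases i
      · simp [Matrix.mulVec, dotProduct, Fin.sum_univ_three]
        linear_combination qD
      · simp [Matrix.mulVec, dotProduct, Fin.sum_univ_three]
        linear_combination qE
      · simp [Matrix.mulVec, dotProduct, Fin.sum_univ_three]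
        linear_combination qF
    rw [Matrix.det_fin_three] at hdet
    simp at hdet
    have b1 : ∀ a b c : ℂ, bracket A B (a • A + b • B + c • C) = c * bracket A B C := by
      intro a b c; simp only [bracket_expand, Pi.add_apply, Pi.smul_apply, smul_eq_mul]; ring
    have b2 : ∀ a b c : ℂ, bracket A C (a • A + b • B + c • C) = - b * bracket A B C := by
      intro a b c; simp only [bracket_expand, Pi.add_apply, Pi.smul_apply, smul_eq_mul]; ring
    have b3 : ∀ a b c a' b' c' : ℂ, bracket C (a • A + b • B + c • C)
        (a' • A + b' • B + c' • C) = (a * b' - b * a') * bracket A B C := by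
      intros; simp only [bracket_expand, Pi.add_apply, Pi.smul_apply, smul_eq_mul]; ring
    have b4 : ∀ a b c a' b' c' : ℂ, bracket B (a • A + b • B + c • C)
        (a' • A + b' • B + c' • C) = (c * a' - a * c') * bracket A B C := by
      intros; simp only [bracket_expand, Pi.add_apply, Pi.smul_apply, smul_eq_mul]; ring
    rw [b1, b1, b2, b2, b3, b3, b4, b4]
    linear_combination ( bracket A B C ^ 4) * hdet
  · intro h
    refine ⟨MvPolynomial.C (bracket A C E * bracket B D E) * (lineForm A B * lineForm C D)
      - MvPolynomial.C (bracket A B E * bracket C D E) * (lineForm A C * lineForm B D),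
      ?_, ?_, ?_, ?_, ?_, ?_, ?_, ?_⟩
    · intro h0
      have h1 := congrArg (eval (A + B)) h0
      simp only [map_sub, map_mul, eval_C, eval_lineForm, map_zero] at h1
      have e1 : bracket A B (A + B) = 0 := by
        simp only [bracket_expand, Pi.add_apply]; ring
      have e2 : bracket A C (A + B) = - bracket A B C := by
        simp only [bracket_expand, Pi.add_apply]; ring
      have e3 : bracket B D (A + B) = bracket A B D := by
        simp only [bracket_expand, Pi.add_apply]; ring
      rw [e1, e2, e3] at h1
      have n1 := bracket_ne_zero_of_indep _ _ _ hABC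
      have n2 := bracket_ne_zero_of_indep _ _ _ hABD
      have n3 := bracket_ne_zero_of_indep _ _ _ hABE
      have n4 := bracket_ne_zero_of_indep _ _ _ hCDE
      refine mul_ne_zero (mul_ne_zero n3 n4) (mul_ne_zero n1 n2) ?_
      linear_combination h1
    · have t : ∀ (k : ℂ) (P Q R S : Fin 3 → ℂ),
          (MvPolynomial.C k * (lineForm P Q * lineForm R S)).IsHomogeneous 2 := by
        intro k P Q R S
        exact ((lineForm_homogeneous P Q).mul (lineForm_homogeneous R S)).C_mul k
      exact (t _ _ _ _ _).sub (t _ _ _ _ _)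
    all_goals simp only [map_sub, map_mul, eval_C, eval_lineForm]
    · simp only [bracket_expand]; ring
    · simp only [bracket_expand]; ring
    · simp only [bracket_expand]; ring
    · simp only [bracket_expand]; ring
    · ring
    · linear_combination h
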